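/- The word 11100 is the shortest tilde-isometric word that is not Ham-isometric: 11100 is tilde-isometric, 11100 is not Ham-isometric, and every tilde-isometric binary word of length at most 4 is Ham-isometric. -/

import Mathlib

/-- One tilde edit step: a replacement (flip one symbol) or a swap of two
adjacent distinct symbols. -/
inductive TStep : List Bool → List Bool → Prop
  | repl (x y : List Bool) (a : Bool) : TStep (x ++ a :: y) (x ++ (!a) :: y)
  | swap (x y : List Bool) (a : Bool) : TStep (x ++ a :: (!a) :: y) (x ++ (!a) :: a :: y)

/-- `reach step h u v` : `v` can be obtained from `u` by a chain of `h` steps. -/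
def reach (step : List Bool → List Bool → Prop) : ℕ → List Bool → List Bool → Prop
  | 0 => Eq
  | h + 1 => fun u v => ∃ w, step u w ∧ reach step h w v

/-- The tilde-distance: the minimum number of replacements and swaps needed to
transform `u` into `v`. -/
noncomputable def tildeDist (u v : List Bool) : ℕ := sInf {h | reach TStep h u v}

theorem TStep.symm {u v : List Bool} (h : TStep u v) : TStep v u := by
  cases h with
  | repl x y a => simpa using TStep.repl x y (!a)
  | swap x y a => simpa using TStep.swap x y (!a)

theorem reach_snoc {step : List Bool → List Bool → Prop} :
    ∀ {h : ℕ} {u v w : List Bool}, reach step h u v → step v w → reach step (h + 1) u w := by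
  intro h
  induction h with
  | zero => intro u v w r s; exact ⟨w, r ▸ s, rfl⟩
  | succ h ih => intro u v w r s; obtain ⟨z, su, rz⟩ := r; exact ⟨z, su, ih rz s⟩

theorem reach_symm : ∀ {h : ℕ} {u v : List Bool}, reach TStep h u v → reach TStep h v u := by
  intro h
  induction h with
  | zero => intro u v r; exact r.symm
  | succ h ih => intro u v r; obtain ⟨w, s, rw⟩ := r; exact reach_snoc (ih rw) s.symm

theorem tildeDist_comm (u v : List Bool) : tildeDist u v = tildeDist v u := by
  unfold tildeDist
  congr 1
  ext h
  exact ⟨fun r => reach_symm r, fun r => reach_symm r⟩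

theorem tildeDist_self (u : List Bool) : tildeDist u u = 0 :=
  Nat.sInf_eq_zero.mpr (Or.inl rfl)

/-- The Hamming distance: the number of positions at which `u` and `v` differ. -/
def hammDist (u v : List Bool) : ℕ := ((u.zip v).filter fun p => p.1 != p.2).length

theorem hammDist_comm : ∀ u v : List Bool, hammDist u v = hammDist v u
  | [], [] => rfl
  | [], _ :: _ => rfl
  | _ :: _, [] => rfl
  | a :: u, b :: v => by
    cases a <;> cases b <;>
      simp [hammDist, List.filter_cons, hammDist_comm u v, hammDist] <;>
      simpa [hammDist] using hammDist_comm u v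

theorem hammDist_self : ∀ u : List Bool, hammDist u u = 0
  | [] => rfl
  | a :: u => by simpa [hammDist, List.filter_cons] using hammDist_self u

/-- Binary words of length `n`. -/
abbrev Word (n : ℕ) := {w : List Bool // w.length = n}

/-- The `n`-tilde-hypercube: vertices are the binary words of length `n`, and
two vertices are adjacent iff their tilde-distance is `1`. -/
noncomputable def tildeCube (n : ℕ) : SimpleGraph (Word n) where
  Adj u v := tildeDist u.val v.val = 1
  symm := by constructor; intro u v h; rwa [tildeDist_comm]
  loopless := by constructor; intro u h; rw [tildeDist_self] at h; exact one_ne_zero h.symm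

/-- The `n`-hypercube: vertices are the binary words of length `n`, and
two vertices are adjacent iff their Hamming distance is `1`. -/
def hamCube (n : ℕ) : SimpleGraph (Word n) where
  Adj u v := hammDist u.val v.val = 1
  symm := by constructor; intro u v h; rwa [hammDist_comm]
  loopless := by constructor; intro u h; rw [hammDist_self] at h; exact one_ne_zero h.symm

/-- `f` is tilde-isometric. -/
def TildeIsometric (f : List Bool) : Prop :=
  ∀ n : ℕ, f.length ≤ n → ∀ u v : List Bool, u.length = n → v.length = n →
    ¬ f <:+: u → ¬ f <:+: v →
    ∃ w : ℕ → List Bool, w 0 = u ∧ w (tildeDist u v) = v ∧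
      (∀ k < tildeDist u v, tildeDist (w k) (w (k + 1)) = 1) ∧
      (∀ k ≤ tildeDist u v, ¬ f <:+: w k)

/-- `f` is Ham-isometric. -/
def HamIsometric (f : List Bool) : Prop :=
  ∀ u v : List Bool, u.length = v.length →
    ¬ f <:+: u → ¬ f <:+: v →
    ∃ w : ℕ → List Bool, w 0 = u ∧ w (hammDist u v) = v ∧
      (∀ k ≤ hammDist u v, (w k).length = u.length) ∧
      (∀ k < hammDist u v, hammDist (w k) (w (k + 1)) = 1) ∧
      (∀ k ≤ hammDist u v, ¬ f <:+: w k)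
/-- The set of words of length `n` avoiding the factor `11`. -/
def fibFree (n : ℕ) : Set (Word n) := {w | ¬ [true, true] <:+: w.val}

/-- The `n`-tilde-Fibonacci cube: the subgraph of the tilde-hypercube induced by
the words avoiding the factor `11`. -/
noncomputable def tildeFibCube (n : ℕ) : SimpleGraph (fibFree n) :=
  (tildeCube n).induce (fibFree n)

/-- The `n`-Fibonacci cube: the subgraph of the hypercube induced by
the words avoiding the factor `11`. -/
def fibCube (n : ℕ) : SimpleGraph (fibFree n) :=
  (hamCube n).induce (fibFree n)

inductive Seg where
  | m (b : Bool)
  | r (b : Bool)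
  | s (b : Bool)
deriving DecidableEq

namespace Seg

def us : Seg → List Bool
  | m b => [b]
  | r b => [b]
  | s b => [b, !b]

def fl : Seg → Seg
  | m b => m b
  | r b => r (!b)
  | s b => s (!b)

def co : Seg → ℕ
  | m _ => 0
  | _ => 1

end Seg

open Seg

def UU : List Seg → List Bool
  | [] => []
  | x :: p => x.us ++ UU p

def FF (p : List Seg) : List Seg := p.map fl

def VV (p : List Seg) : List Bool := UU (FF p)

def CC : List Seg → ℕ
  | [] => 0
  | x :: p => x.co + CC p

theorem UU_append (p q : List Seg) : UU (p ++ q) = UU p ++ UU q := by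
  induction p with
  | nil => rfl
  | cons x p ih => simp [UU, ih]

theorem FF_append (p q : List Seg) : FF (p ++ q) = FF p ++ FF q := by simp [FF]

theorem VV_append (p q : List Seg) : VV (p ++ q) = VV p ++ VV q := by
  simp [VV, FF_append, UU_append]

theorem CC_append (p q : List Seg) : CC (p ++ q) = CC p + CC q := by
  induction p with
  | nil => simp [CC]
  | cons x p ih => simp [CC, ih, Nat.add_assoc]

theorem fl_fl (x : Seg) : fl (fl x) = x := by cases x <;> simp [fl]

theorem FF_FF (p : List Seg) : FF (FF p) = p := by
  simp only [FF, List.map_map]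
  conv_rhs => rw [← List.map_id p]
  congr 1
  funext x
  exact fl_fl x

theorem CC_FF (p : List Seg) : CC (FF p) = CC p := by
  induction p with
  | nil => rfl
  | cons x p ih => cases x <;> simpa [FF, CC, fl, co] using ih

/-- moves at the head -/
def hmoves : List Seg → List (List Seg)
  | r b :: s c :: p =>
      (m (!b) :: s c :: p) ::
        (if c = !b then [m (!b) :: m b :: r b :: p, s b :: m (!b) :: p] else [])
  | s b :: r c :: p =>
      (m (!b) :: m b :: r c :: p) ::
        (if c = b then [m (!b) :: s (!b) :: p, r b :: m b :: m (!b) :: p] else [])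
  | r b :: p => [m (!b) :: p]
  | s b :: p => [m (!b) :: m b :: p]
  | _ => []

def umoves : List Seg → List (List Seg)
  | [] => []
  | x :: p => hmoves (x :: p) ++ (umoves p).map (x :: ·)

theorem TStep.cons {u v : List Bool} (a : Bool) (h : TStep u v) : TStep (a :: u) (a :: v) := by
  cases h with
  | repl x y b => exact TStep.repl (a :: x) y b
  | swap x y b => exact TStep.swap (a :: x) y b

theorem TStep.pre {u v : List Bool} (z : List Bool) (h : TStep u v) : TStep (z ++ u) (z ++ v) := by
  induction z with
  | nil => exact h
  | cons a z ih => exact ih.cons a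

theorem TStep.h1 (y : List Bool) (a : Bool) : TStep (a :: y) ((!a) :: y) := TStep.repl [] y a
theorem TStep.h2 (y : List Bool) (a : Bool) : TStep (a :: (!a) :: y) ((!a) :: a :: y) :=
  TStep.swap [] y a

theorem TStep.ne {u v : List Bool} (h : TStep u v) : u ≠ v := by
  cases h <;> simp

theorem TStep.len {u v : List Bool} (h : TStep u v) : u.length = v.length := by
  cases h <;> simp

theorem hmoves_append {p p' : List Seg} (q : List Seg) (h : p' ∈ hmoves p) (hl : p ≠ []) :
    p' ++ q ∈ hmoves (p ++ q) := by
  match p, hl with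
  | m b :: p, _ => simp [hmoves] at h
  | [r b], _ =>
    simp [hmoves] at h
    subst h
    match q with
    | [] => simp [hmoves]
    | m c :: q => simp [hmoves]
    | r c :: q => simp [hmoves]
    | s c :: q => simp [hmoves]
  | [s b], _ =>
    simp [hmoves] at h
    subst h
    match q with
    | [] => simp [hmoves]
    | m c :: q => simp [hmoves]
    | r c :: q => simp [hmoves]
    | s c :: q => simp [hmoves]
  | r b :: m c :: p, _ => simp_all [hmoves]
  | r b :: r c :: p, _ => simp_all [hmoves]
  | r b :: s c :: p, _ =>
    simp only [hmoves, List.cons_append] at h ⊢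
    by_cases hc : c = !b <;> simp [hc] at h ⊢
    · rcases h with h | h | h <;> simp [h]
    · simp [h]
  | s b :: m c :: p, _ => simp_all [hmoves]
  | s b :: s c :: p, _ => simp_all [hmoves]
  | s b :: r c :: p, _ =>
    simp only [hmoves, List.cons_append] at h ⊢
    by_cases hc : c = b <;> simp [hc] at h ⊢
    · rcases h with h | h | h <;> simp [h]
    · simp [h]

theorem umoves_append {p p' : List Seg} (q : List Seg) (h : p' ∈ umoves p) :
    p' ++ q ∈ umoves (p ++ q) := by
  induction p generalizing p' with
  | nil => simp [umoves] at h
  | cons x p ih =>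
    simp only [umoves, List.mem_append, List.mem_map, List.cons_append] at h ⊢
    rcases h with h | ⟨a, ha, rfl⟩
    · left; exact hmoves_append q h (by simp)
    · right; exact ⟨a ++ q, ih ha, by simp⟩

theorem umoves_pre {p p' : List Seg} (q : List Seg) (h : p' ∈ umoves p) :
    q ++ p' ∈ umoves (q ++ p) := by
  induction q with
  | nil => exact h
  | cons x q ih =>
    simp only [umoves, List.mem_append, List.mem_map, List.cons_append]
    right; exact ⟨_, ih, rfl⟩

theorem hmoves_spec {p p' : List Seg} (h : p' ∈ hmoves p) :
    CC p' + 1 = CC p ∧ VV p' = VV p ∧ TStep (UU p) (UU p') := by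
  have key1 : ∀ b p, CC (m (!b) :: p) + 1 = CC (r b :: p) ∧ VV (m (!b) :: p) = VV (r b :: p) ∧
      TStep (UU (r b :: p)) (UU (m (!b) :: p)) := by
    intro b p
    refine ⟨by simp [CC, co]; omega, by simp [VV, FF, fl, UU, us], ?_⟩
    simpa [UU, us] using TStep.h1 (UU p) b
  have key2 : ∀ b p, CC (m (!b) :: m b :: p) + 1 = CC (s b :: p) ∧
      VV (m (!b) :: m b :: p) = VV (s b :: p) ∧
      TStep (UU (s b :: p)) (UU (m (!b) :: m b :: p)) := by
    intro b p
    refine ⟨by simp [CC, co]; omega, by simp [VV, FF, fl, UU, us], ?_⟩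
    simpa [UU, us] using TStep.h2 (UU p) b
  match p with
  | [] => simp [hmoves] at h
  | m b :: p => simp [hmoves] at h
  | [r b] => simp [hmoves] at h; subst h; exact key1 _ _
  | [s b] => simp [hmoves] at h; subst h; exact key2 _ _
  | r b :: m c :: p => simp [hmoves] at h; subst h; exact key1 _ _
  | r b :: r c :: p => simp [hmoves] at h; subst h; exact key1 _ _
  | s b :: m c :: p => simp [hmoves] at h; subst h; exact key2 _ _
  | s b :: s c :: p => simp [hmoves] at h; subst h; exact key2 _ _
  | r b :: s c :: p =>
    simp only [hmoves, List.mem_cons] at h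
    rcases h with h | h
    · subst h; exact key1 _ _
    by_cases hc : c = !b <;> simp [hc] at h
    subst hc
    rcases h with h | h <;> subst h
    · refine ⟨by simp [CC, co]; omega, by simp [VV, FF, fl, UU, us], ?_⟩
      simpa [UU, us] using TStep.h2 (b :: UU p) b
    · refine ⟨by simp [CC, co]; omega, by simp [VV, FF, fl, UU, us], ?_⟩
      simpa [UU, us] using ((TStep.h1 (UU p) b).cons (!b)).cons b
  | s b :: r c :: p =>
    simp only [hmoves, List.mem_cons] at h
    rcases h with h | h
    · subst h; exact key2 _ _
    by_cases hc : c = b <;> simp [hc] at h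
    subst hc
    rcases h with h | h <;> subst h
    · refine ⟨by simp [CC, co]; omega, by simp [VV, FF, fl, UU, us], ?_⟩
      simpa [UU, us] using TStep.h1 ((!c) :: c :: UU p) c
    · refine ⟨by simp [CC, co]; omega, by simp [VV, FF, fl, UU, us], ?_⟩
      simpa [UU, us] using (TStep.h2 (UU p) (!c)).cons c

theorem VV_cons (x : Seg) (p : List Seg) : VV (x :: p) = x.fl.us ++ VV p := rfl

theorem umoves_spec {p p' : List Seg} (h : p' ∈ umoves p) :
    CC p' + 1 = CC p ∧ VV p' = VV p ∧ TStep (UU p) (UU p') := by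
  induction p generalizing p' with
  | nil => simp [umoves] at h
  | cons x p ih =>
    simp only [umoves, List.mem_append, List.mem_map] at h
    rcases h with h | ⟨a, ha, rfl⟩
    · exact hmoves_spec h
    · obtain ⟨h1, h2, h3⟩ := ih ha
      refine ⟨by simp only [CC]; omega, by rw [VV_cons, VV_cons, h2], h3.pre _⟩

/-- hamming version -/
def NS (p : List Seg) : Prop := ∀ x ∈ p, ∀ b, x ≠ s b

theorem NS_FF {p : List Seg} (h : NS p) : NS (FF p) := by
  intro x hx b e
  simp only [FF, List.mem_map] at hx
  obtain ⟨a, ha, rfl⟩ := hx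
  cases a <;> simp [fl] at e
  exact h _ ha _ rfl

theorem hammDist_cons (a b : Bool) (u v : List Bool) :
    hammDist (a :: u) (b :: v) = (if a = b then 0 else 1) + hammDist u v := by
  cases a <;> cases b <;> simp [hammDist, List.filter_cons] <;> omega

theorem hamm_CC {p : List Seg} (h : NS p) : hammDist (UU p) (VV p) = CC p := by
  induction p with
  | nil => rfl
  | cons x p ih =>
    have := ih (fun y hy => h y (by simp [hy]))
    cases x with
    | m b => simp [UU, us, VV_cons, fl, hammDist_cons, CC, co, this]
    | r b => cases b <;> simp [UU, us, VV_cons, fl, hammDist_cons, CC, co, this]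
    | s b => exact absurd rfl (h (s b) (by simp) b)

theorem umoves_ham {p p' : List Seg} (hn : NS p) (h : p' ∈ umoves p) :
    NS p' ∧ hammDist (UU p) (UU p') = 1 := by
  induction p generalizing p' with
  | nil => simp [umoves] at h
  | cons x p ih =>
    have hn' : NS p := fun y hy => hn y (by simp [hy])
    simp only [umoves, List.mem_append, List.mem_map] at h
    rcases h with h | ⟨a, ha, rfl⟩
    · cases x with
      | m b => simp [hmoves] at h
      | s b => exact absurd rfl (hn (s b) (by simp) b)
      | r b =>
        have : p' = m (!b) :: p := by
          match p, hn', h with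
          | [], _, h => simpa [hmoves] using h
          | m c :: q, _, h => simpa [hmoves] using h
          | r c :: q, _, h => simpa [hmoves] using h
          | s c :: q, hn', h => exact absurd rfl (hn' (s c) (by simp) c)
        subst this
        constructor
        · intro y hy c
          simp only [List.mem_cons] at hy
          rcases hy with rfl | hy
          · simp
          · exact hn' y hy c
        · simp [UU, us, hammDist_cons, hammDist_self]
    · obtain ⟨h1, h2⟩ := ih hn' ha
      constructor
      · intro y hy c
        simp only [List.mem_cons] at hy
        rcases hy with rfl | hy
        · exact hn y (by simp) c
        · exact h1 y hy c
      · cases x with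
        | m b => simpa [UU, us, hammDist_cons] using h2
        | r b => simpa [UU, us, hammDist_cons] using h2
        | s b => exact absurd rfl (hn (s b) (by simp) b)

/-! factor lemmas -/
theorem infix_split {f x y : List Bool} (h : f <:+: x ++ y) :
    f <:+: x ∨ f <:+: y ∨ ∃ a b, f = a ++ b ∧ a ≠ [] ∧ b ≠ [] ∧ a <:+ x ∧ b <+: y := by
  obtain ⟨l, t, e⟩ := h
  rw [List.append_assoc] at e
  rcases List.append_eq_append_iff.1 e with ⟨c, h1, h2⟩ | ⟨c, h1, h2⟩
  · rcases List.append_eq_append_iff.1 h2 with ⟨d, h3, h4⟩ | ⟨d, h3, h4⟩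
    · left; exact ⟨l, d, by simp [h1, h3]⟩
    · by_cases hc : c = []
      · right; left; exact ⟨[], t, by simp_all⟩
      by_cases hd : d = []
      · left; exact ⟨l, [], by simp_all⟩
      right; right
      exact ⟨c, d, h3, hc, hd, ⟨l, h1.symm⟩, ⟨t, h4.symm⟩⟩
  · right; left; exact ⟨c, t, by simp [h2]⟩

def safe (f x y : List Bool) : Bool :=
  decide (¬ f <:+: y) && f.inits.all (fun a => decide (a <:+ y → a <:+ x))

theorem safe_append {f x y r : List Bool} (h : safe f x y = true) (hx : ¬ f <:+: x ++ r) :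
    ¬ f <:+: y ++ r := by
  simp only [safe, Bool.and_eq_true, decide_eq_true_eq, List.all_eq_true, List.mem_inits] at h
  obtain ⟨h1, h2⟩ := h
  intro hf
  rcases infix_split hf with hf | hf | ⟨a, b, e, _, _, ha, hb⟩
  · exact h1 hf
  · exact hx (hf.trans (List.suffix_append _ _).isInfix)
  · obtain ⟨l, hl⟩ := h2 a ⟨b, e.symm⟩ ha
    obtain ⟨t, ht⟩ := hb
    exact hx ⟨l, t, by rw [e, ← hl, ← ht]; simp⟩

theorem left_ctx {f z c y : List Bool} (hc : f.length ≤ c.length + 1)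
    (h1 : ¬ f <:+: z ++ c) (h2 : ¬ f <:+: c ++ y) : ¬ f <:+: z ++ (c ++ y) := by
  intro hf
  rcases infix_split hf with hf | hf | ⟨a, b, e, ha0, _, ha, hb⟩
  · exact h1 (hf.trans (List.prefix_append _ _).isInfix)
  · exact h2 hf
  · have hl : b.length ≤ c.length := by
      have : 0 < a.length := List.length_pos_iff.2 ha0
      rw [e] at hc
      simp at hc
      omega
    obtain ⟨t, ht⟩ := List.prefix_of_prefix_length_le hb (List.prefix_append c y) hl
    obtain ⟨l, hl⟩ := ha
    exact h1 ⟨l, t, by rw [e, ← hl, ← ht]; simp⟩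

/-! checker -/
def endOk (f : List Bool) (p : List Seg) : Bool :=
  (umoves p).any (fun q => decide (¬ f <:+: UU q)) ||
  (umoves (FF p)).any (fun q => decide (¬ f <:+: UU q))

def nowOk (f : List Bool) (p : List Seg) : Bool :=
  (umoves p).any (fun q => safe f (UU p) (UU q)) ||
  (umoves (FF p)).any (fun q => safe f (VV p) (UU q))

def prune (B : List (List Seg)) (f : List Bool) (p : List Seg) : Bool :=
  decide (f <:+: UU p) || (decide (f <:+: VV p) || B.any (fun q => decide (q <:+: p)))

def chk (B : List (List Seg)) (f : List Bool) : ℕ → List Seg → Bool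
  | 0, p => prune B f p || nowOk f p
  | n + 1, p => prune B f p || (nowOk f p || (endOk f p &&
      [m true, m false, r true, r false, s true, s false].all (fun x => chk B f n (p ++ [x]))))

def Res (f : List Bool) (p : List Seg) : Prop :=
  (∃ q ∈ umoves p, ¬ f <:+: UU q) ∨ (∃ q ∈ umoves (FF p), ¬ f <:+: UU q)

theorem prune_false {B : List (List Seg)} {f : List Bool} {p t : List Seg}
    (hB : ∀ q ∈ B, ¬ q <:+: p ++ t) (hu : ¬ f <:+: UU (p ++ t)) (hv : ¬ f <:+: VV (p ++ t)) :
    prune B f p = false := by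
  rw [UU_append] at hu
  rw [VV_append] at hv
  simp only [prune, Bool.or_eq_false_iff, decide_eq_false_iff_not, List.any_eq_false,
    decide_eq_true_eq]
  exact ⟨fun h => hu (h.trans (List.prefix_append _ _).isInfix),
    fun h => hv (h.trans (List.prefix_append _ _).isInfix),
    fun q hq h => hB q hq (h.trans (List.prefix_append _ _).isInfix)⟩

theorem nowOk_res {f : List Bool} {p t : List Seg} (h : nowOk f p = true)
    (hu : ¬ f <:+: UU (p ++ t)) (hv : ¬ f <:+: VV (p ++ t)) : Res f (p ++ t) := by
  simp only [nowOk, Bool.or_eq_true, List.any_eq_true] at h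
  rcases h with ⟨q, hq, hs⟩ | ⟨q, hq, hs⟩
  · left
    refine ⟨q ++ t, umoves_append t hq, ?_⟩
    rw [UU_append] at hu ⊢
    exact safe_append hs hu
  · right
    refine ⟨q ++ FF t, by rw [FF_append]; exact umoves_append _ hq, ?_⟩
    rw [VV_append] at hv
    rw [UU_append]
    exact safe_append hs hv

theorem endOk_res {f : List Bool} {p : List Seg} (h : endOk f p = true) : Res f p := by
  simpa [endOk, Res] using h

theorem chk_res {B : List (List Seg)} {f : List Bool} (n : ℕ) : ∀ (p t : List Seg),
    chk B f n p = true → (∀ q ∈ B, ¬ q <:+: p ++ t) →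
    ¬ f <:+: UU (p ++ t) → ¬ f <:+: VV (p ++ t) → Res f (p ++ t) := by
  induction n with
  | zero =>
    intro p t h hB hu hv
    simp only [chk, prune_false hB hu hv, Bool.false_or] at h
    exact nowOk_res h hu hv
  | succ n ih =>
    intro p t h hB hu hv
    simp only [chk, prune_false hB hu hv, Bool.false_or, Bool.or_eq_true, Bool.and_eq_true,
      List.all_eq_true] at h
    rcases h with h | ⟨h1, h2⟩
    · exact nowOk_res h hu hv
    · cases t with
      | nil => simpa using endOk_res h1
      | cons x t =>
        have e : p ++ x :: t = (p ++ [x]) ++ t := by simp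
        rw [e] at hB hu hv ⊢
        refine ih _ _ (h2 x ?_) hB hu hv
        cases x with
        | m b => cases b <;> simp
        | r b => cases b <;> simp
        | s b => cases b <;> simp

def ctxs : ℕ → List (List Bool)
  | 0 => [[]]
  | n + 1 => [] :: (ctxs n).flatMap (fun c => [true :: c, false :: c])

theorem mem_ctxs (n : ℕ) : ∀ c : List Bool, c.length ≤ n → c ∈ ctxs n := by
  induction n with
  | zero => intro c h; simp at h; simp [ctxs, h]
  | succ n ih =>
    intro c h
    cases c with
    | nil => simp [ctxs]
    | cons a c =>
      simp only [ctxs, List.mem_cons, List.mem_flatMap]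
      right
      refine ⟨c, ih c (by simpa using h), ?_⟩
      cases a <;> simp

def full (B : List (List Seg)) (f : List Bool) : Bool :=
  decide (f.length ≤ 5) &&
  (ctxs 4).all (fun c => [r true, r false, s true, s false].all (fun x =>
    chk B f 3 (c.map m ++ [x])))

theorem split_first (p : List Seg) (h : 0 < CC p) : ∃ (z : List Bool) (x : Seg) (t : List Seg),
    p = z.map m ++ x :: t ∧ x ∈ [r true, r false, s true, s false] := by
  induction p with
  | nil => simp [CC] at h
  | cons x p ih =>
    cases x with
    | m b =>
      obtain ⟨z, x, t, e, hx⟩ := ih (by simpa [CC, co] using h)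
      exact ⟨b :: z, x, t, by simp [e], hx⟩
    | r b => exact ⟨[], r b, p, rfl, by cases b <;> simp⟩
    | s b => exact ⟨[], s b, p, rfl, by cases b <;> simp⟩

theorem UU_m (z : List Bool) : UU (z.map m) = z := by
  induction z with
  | nil => rfl
  | cons a z ih => simp [UU, us, ih]

theorem FF_m (z : List Bool) : FF (z.map m) = z.map m := by
  simp [FF, fl]

theorem VV_m (z : List Bool) : VV (z.map m) = z := by
  rw [VV, FF_m, UU_m]

theorem umoves_m {z : List Bool} {t q : List Seg} (h : q ∈ umoves (z.map m ++ t)) :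
    ∃ q' ∈ umoves t, q = z.map m ++ q' := by
  induction z generalizing q with
  | nil => exact ⟨q, h, rfl⟩
  | cons a z ih =>
    simp only [List.map_cons, List.cons_append, umoves, hmoves, List.nil_append,
      List.mem_map] at h
    obtain ⟨b, hb, rfl⟩ := h
    obtain ⟨q', h1, rfl⟩ := ih hb
    exact ⟨q', h1, rfl⟩

theorem full_res {B : List (List Seg)} {f : List Bool} (h : full B f = true) (p : List Seg)
    (hp : 0 < CC p) (hB : ∀ q ∈ B, ¬ q <:+: p) (hu : ¬ f <:+: UU p) (hv : ¬ f <:+: VV p) :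
    Res f p := by
  obtain ⟨z, x, t, rfl, hx⟩ := split_first p hp
  simp only [full, Bool.and_eq_true, decide_eq_true_eq, List.all_eq_true] at h
  obtain ⟨hf, h⟩ := h
  obtain ⟨z', c, rfl, hc, hz⟩ : ∃ z' c, z = z' ++ c ∧ c.length ≤ 4 ∧ (z' = [] ∨ c.length = 4) := by
    by_cases hz : z.length ≤ 4
    · exact ⟨[], z, rfl, hz, Or.inl rfl⟩
    · refine ⟨z.take (z.length - 4), z.drop (z.length - 4), by simp, ?_, Or.inr ?_⟩ <;>
      simp <;> omega
  have e : (z' ++ c).map m ++ x :: t = z'.map m ++ ((c.map m ++ [x]) ++ t) := by simp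
  rw [e] at hB hu hv ⊢
  have hu' := hu
  have hv' := hv
  rw [UU_append] at hu'
  rw [VV_append] at hv'
  have R := chk_res 3 _ t (h c (mem_ctxs 4 c hc) x hx)
    (fun q hq hh => hB q hq (hh.trans (List.suffix_append _ _).isInfix))
    (fun hh => hu' (hh.trans (List.suffix_append _ _).isInfix))
    (fun hh => hv' (hh.trans (List.suffix_append _ _).isInfix))
  have zc : ¬ f <:+: z' ++ c := by
    intro hh
    apply hu
    refine hh.trans ?_
    rw [UU_append, UU_append, UU_append, UU_m, UU_m]
    exact ⟨[], UU [x] ++ UU t, by simp⟩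
  have fin : ∀ y, ¬ f <:+: c ++ y → ¬ f <:+: z' ++ (c ++ y) := by
    intro y hy
    rcases hz with rfl | hz
    · simpa using hy
    · exact left_ctx (by omega) zc hy
  rcases R with ⟨q, hq, hfq⟩ | ⟨q, hq, hfq⟩
  · left
    refine ⟨_, umoves_pre _ hq, ?_⟩
    rw [List.append_assoc] at hq
    obtain ⟨q', _, rfl⟩ := umoves_m hq
    rw [UU_append, UU_m] at hfq
    rw [UU_append, UU_append, UU_m, UU_m]
    exact fin _ hfq
  · right
    refine ⟨z'.map m ++ q, by rw [FF_append, FF_m]; exact umoves_pre _ hq, ?_⟩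
    rw [List.append_assoc, FF_append, FF_m] at hq
    obtain ⟨q', _, rfl⟩ := umoves_m hq
    rw [UU_append, UU_m] at hfq
    rw [UU_append, UU_append, UU_m, UU_m]
    exact fin _ hfq

/-! paths -/
theorem reach_fun {S : List Bool → List Bool → Prop} : ∀ (h : ℕ) (u v : List Bool),
    reach S h u v → ∃ w : ℕ → List Bool, w 0 = u ∧ w h = v ∧ ∀ k < h, S (w k) (w (k + 1)) := by
  intro h
  induction h with
  | zero => intro u v r; exact ⟨fun _ => u, rfl, r, by simp⟩
  | succ h ih =>
    rintro u v ⟨a, ha, hr⟩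
    obtain ⟨w, h0, h1, h2⟩ := ih a v hr
    refine ⟨fun k => Nat.casesOn k u w, rfl, h1, ?_⟩
    intro k hk
    cases k with
    | zero => simpa [h0] using ha
    | succ k => exact h2 k (by omega)

theorem build {S : List Bool → List Bool → Prop} {f : List Bool}
    (Q : ℕ → List Bool → List Bool → Prop)
    (h0 : ∀ u v, Q 0 u v → u = v)
    (hs : ∀ h u v, ¬ f <:+: u → ¬ f <:+: v → Q (h + 1) u v → ∃ w, ¬ f <:+: w ∧
      (S u w ∧ Q h w v ∨ S w v ∧ Q h u w)) :
    ∀ h u v, ¬ f <:+: u → ¬ f <:+: v → Q h u v →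
      reach (fun a b => S a b ∧ ¬ f <:+: b) h u v := by
  intro h
  induction h with
  | zero => intro u v _ _ q; exact h0 u v q
  | succ h ih =>
    intro u v hu hv q
    obtain ⟨w, hw, ⟨h1, h2⟩ | ⟨h1, h2⟩⟩ := hs h u v hu hv q
    · exact ⟨w, ⟨h1, hw⟩, ih w v hw hv h2⟩
    · exact reach_snoc (ih u w hu hw h2) ⟨h1, hv⟩

theorem path_free {S : List Bool → List Bool → Prop} {f u : List Bool} {h : ℕ}
    {w : ℕ → List Bool} (hu : ¬ f <:+: u) (h0 : w 0 = u)
    (hw : ∀ k < h, S (w k) (w (k + 1)) ∧ ¬ f <:+: w (k + 1)) : ∀ k ≤ h, ¬ f <:+: w k := by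
  intro k hk
  cases k with
  | zero => rwa [h0]
  | succ k => exact (hw k (by omega)).2

/-! tilde distance -/
theorem tilde_le {h : ℕ} {u v : List Bool} (r : reach TStep h u v) : tildeDist u v ≤ h :=
  Nat.sInf_le r

theorem tilde_mem {h : ℕ} {u v : List Bool} (r : reach TStep h u v) :
    reach TStep (tildeDist u v) u v := Nat.sInf_mem (s := {h | reach TStep h u v}) ⟨h, r⟩

theorem tilde_one_of {u v : List Bool} (h : TStep u v) : tildeDist u v = 1 := by
  have r : reach TStep 1 u v := ⟨v, h, rfl⟩
  have h1 := tilde_le r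
  have h2 := tilde_mem r
  rcases Nat.lt_or_ge (tildeDist u v) 1 with h3 | h3
  · have : tildeDist u v = 0 := by omega
    rw [this] at h2
    exact absurd h2 h.ne
  · omega

theorem step_of_tilde_one {u v : List Bool} (h : tildeDist u v = 1) : TStep u v := by
  have hn : ({h | reach TStep h u v} : Set ℕ).Nonempty :=
    Nat.nonempty_of_pos_sInf (by rw [tildeDist] at h; omega)
  have := Nat.sInf_mem hn
  change reach TStep (tildeDist u v) u v at this
  rw [h] at this
  obtain ⟨w, hw, e⟩ := this
  cases e
  exact hw

theorem reach_pre {h : ℕ} (z : List Bool) : ∀ {u v : List Bool}, reach TStep h u v →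
    reach TStep h (z ++ u) (z ++ v) := by
  induction h with
  | zero => intro u v e; cases e; rfl
  | succ h ih => rintro u v ⟨w, h1, h2⟩; exact ⟨z ++ w, h1.pre z, ih h2⟩

theorem reach_CC (p : List Seg) : reach TStep (CC p) (UU p) (VV p) := by
  induction p with
  | nil => rfl
  | cons x p ih =>
    cases x with
    | m b => simpa [CC, co, UU, us, VV_cons, fl] using reach_pre [b] ih
    | r b =>
      change reach TStep (1 + CC p) _ _
      rw [Nat.add_comm]
      refine ⟨(!b) :: UU p, TStep.h1 _ _, ?_⟩
      exact reach_pre [!b] ih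
    | s b =>
      change reach TStep (1 + CC p) _ _
      rw [Nat.add_comm]
      refine ⟨(!b) :: b :: UU p, TStep.h2 _ _, ?_⟩
      simpa [VV_cons, fl, us] using reach_pre [!b, b] ih

/-- single-letter segment with given letters -/
def sg (a b : Bool) : Seg := if a = b then m a else r a

theorem sg_us (a b : Bool) : (sg a b).us = [a] := by
  unfold sg; split <;> rfl
theorem sg_fl (a b : Bool) : (sg a b).fl.us = [b] := by
  cases a <;> cases b <;> rfl
theorem sg_co (a b : Bool) : (sg a b).co ≤ 1 := by
  cases a <;> cases b <;> simp [sg, co]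

theorem exists_parse : ∀ (u v : List Bool), u.length = v.length →
    ∃ p, NS p ∧ UU p = u ∧ VV p = v
  | [], [], _ => ⟨[], by simp [NS], rfl, rfl⟩
  | [], _ :: _, h => by simp at h
  | _ :: _, [], h => by simp at h
  | a :: u, b :: v, h => by
    obtain ⟨p, h0, h1, h2⟩ := exists_parse u v (by simpa using h)
    refine ⟨sg a b :: p, ?_, by simp [UU, sg_us, h1], by simp [VV_cons, sg_fl, h2]⟩
    intro x hx c
    simp only [List.mem_cons] at hx
    rcases hx with rfl | hx
    · unfold sg; split <;> simp
    · exact h0 x hx c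

def Par (u v : List Bool) (h : ℕ) : Prop := ∃ p, UU p = u ∧ VV p = v ∧ CC p ≤ h

theorem Par.cons {u v : List Bool} {h : ℕ} (x : Seg) (hp : Par u v h) :
    Par (x.us ++ u) (x.fl.us ++ v) (x.co + h) := by
  obtain ⟨p, h1, h2, h3⟩ := hp
  exact ⟨x :: p, by simp [UU, h1], by simp [VV_cons, h2], by simp only [CC]; omega⟩

theorem Par.mono {u v : List Bool} {h k : ℕ} (hp : Par u v h) (hk : h ≤ k) : Par u v k := by
  obtain ⟨p, h1, h2, h3⟩ := hp
  exact ⟨p, h1, h2, by omega⟩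

theorem Par.one {u v : List Bool} {h : ℕ} (a b : Bool) (hp : Par u v h) :
    Par (a :: u) (b :: v) (1 + h) := by
  have := hp.cons (sg a b)
  rw [sg_us, sg_fl] at this
  exact this.mono (by have := sg_co a b; omega)

theorem Par.eq {u v : List Bool} {h : ℕ} (a : Bool) (hp : Par u v h) :
    Par (a :: u) (a :: v) h := by
  simpa [us, fl, co] using hp.cons (m a)

theorem Par.sw {u v : List Bool} {h : ℕ} (a : Bool) (hp : Par u v h) :
    Par (a :: (!a) :: u) ((!a) :: a :: v) (1 + h) := by
  simpa [us, fl, co] using hp.cons (s a)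

theorem Par.of (p : List Seg) : Par (UU p) (VV p) (CC p) := ⟨p, rfl, rfl, le_rfl⟩

/-- first letter of `u` arbitrary -/
theorem Par.chg {p : List Seg} {a : Bool} {y : List Bool} (h : UU p = a :: y) (b : Bool) :
    ∃ c v, VV p = c :: v ∧ Par (b :: y) (c :: v) (1 + CC p) ∧
      Par y v (CC p) ∧ (a ≠ c → b = c → Par (b :: y) (c :: v) (CC p)) := by
  match p with
  | [] => simp [UU] at h
  | m c :: p =>
    simp [UU, us] at h
    obtain ⟨rfl, rfl⟩ := h
    refine ⟨c, VV p, rfl, ?_, ?_, fun h => absurd rfl h⟩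
    · exact ((Par.of p).one b c).mono (by simp [CC, co])
    · exact (Par.of p).mono (by simp [CC, co])
  | r c :: p =>
    simp [UU, us] at h
    obtain ⟨rfl, rfl⟩ := h
    refine ⟨!c, VV p, rfl, ?_, ?_, fun _ e => ?_⟩
    · exact ((Par.of p).one b (!c)).mono (by simp [CC, co])
    · exact (Par.of p).mono (by simp [CC, co])
    · subst e; exact ((Par.of p).eq (!c)).mono (by simp [CC, co])
  | s c :: p =>
    simp [UU, us] at h
    obtain ⟨rfl, rfl⟩ := h
    have h1 : Par ((!c) :: UU p) (c :: VV p) (1 + CC p) := (Par.of p).one _ _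
    refine ⟨!c, c :: VV p, by simp [VV_cons, fl, us], ?_, ?_, fun _ e => ?_⟩
    · exact (h1.one b (!c)).mono (by simp [CC, co])
    · exact h1.mono (by simp [CC, co])
    · subst e; exact (h1.eq (!c)).mono (by simp [CC, co])

theorem back_repl (p : List Seg) : ∀ (x y : List Bool) (a b : Bool), UU p = x ++ a :: y →
    Par (x ++ b :: y) (VV p) (1 + CC p) := by
  induction p with
  | nil => intro x y a b h; simp [UU] at h
  | cons e p ih =>
    intro x y a b h
    cases x with
    | nil =>
      obtain ⟨c, v, h1, h2, _⟩ := Par.chg h b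
      rw [h1]; exact h2
    | cons z x =>
      cases e with
      | m c =>
        simp [UU, us] at h
        obtain ⟨rfl, h⟩ := h
        exact ((ih x y a b h).cons (m c)).mono (by simp [CC, co])
      | r c =>
        simp [UU, us] at h
        obtain ⟨rfl, h⟩ := h
        exact ((ih x y a b h).cons (r c)).mono (by simp [CC, co])
      | s c =>
        cases x with
        | nil =>
          simp only [UU, us, List.cons_append, List.nil_append, List.cons.injEq] at h
          obtain ⟨rfl, rfl, rfl⟩ := h
          have := ((Par.of p).one b c).one c (!c)
          simpa [VV_cons, fl, us, CC, co] using this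
        | cons z' x =>
          simp only [UU, us, List.cons_append, List.nil_append, List.cons.injEq] at h
          obtain ⟨rfl, rfl, h⟩ := h
          exact ((ih x y a b h).cons (s c)).mono (by simp [CC, co])

theorem back_swap (p : List Seg) : ∀ (x y : List Bool) (a : Bool), UU p = x ++ a :: (!a) :: y →
    Par (x ++ (!a) :: a :: y) (VV p) (1 + CC p) := by
  induction p with
  | nil => intro x y a h; simp [UU] at h
  | cons e p ih =>
    intro x y a h
    cases x with
    | nil =>
      cases e with
      | m c =>
        simp [UU, us] at h
        obtain ⟨rfl, h⟩ := h
        obtain ⟨d, v, h1, h2, h3, h4⟩ := Par.chg h c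
        have : VV (m c :: p) = c :: d :: v := by simp [VV_cons, fl, us, h1]
        rw [this]
        by_cases hd : d = c
        · subst hd
          exact ((h4 (by simp) rfl).one (!d) d).mono (by simp [CC, co])
        · have : d = !c := by cases c <;> cases d <;> simp_all
          subst this
          have := h3.sw (!c)
          simpa [CC, co] using this
      | r c =>
        simp [UU, us] at h
        obtain ⟨rfl, h⟩ := h
        obtain ⟨d, v, h1, h2, h3, h4⟩ := Par.chg h c
        have : VV (r c :: p) = (!c) :: d :: v := by simp [VV_cons, fl, us, h1]
        rw [this]
        exact (h2.eq (!c)).mono (by simp [CC, co])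
      | s c =>
        simp [UU, us] at h
        obtain ⟨rfl, rfl⟩ := h
        have := ((Par.of p).eq c).eq (!c)
        refine Par.mono (h := CC p) ?_ (by simp [CC, co]; omega)
        simpa [VV_cons, fl, us] using this
    | cons z x =>
      cases e with
      | m c =>
        simp [UU, us] at h
        obtain ⟨rfl, h⟩ := h
        exact ((ih x y a h).cons (m c)).mono (by simp [CC, co])
      | r c =>
        simp [UU, us] at h
        obtain ⟨rfl, h⟩ := h
        exact ((ih x y a h).cons (r c)).mono (by simp [CC, co])
      | s c =>
        cases x with
        | nil =>
          simp only [UU, us, List.cons_append, List.nil_append, List.cons.injEq] at h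
          obtain ⟨rfl, rfl, h⟩ := h
          obtain ⟨d, v, h1, h2, h3, h4⟩ := Par.chg h (!c)
          have : VV (s c :: p) = (!c) :: c :: d :: v := by simp [VV_cons, fl, us, h1]
          rw [this]
          have := (h2.eq c).one c (!c)
          simpa [CC, co] using this
        | cons z' x =>
          simp only [UU, us, List.cons_append, List.nil_append, List.cons.injEq] at h
          obtain ⟨rfl, rfl, h⟩ := h
          exact ((ih x y a h).cons (s c)).mono (by simp [CC, co])

theorem reach_par : ∀ (h : ℕ) (u v : List Bool), reach TStep h u v → Par u v h := by
  intro h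
  induction h with
  | zero =>
    intro u v e
    cases e
    have := Par.of (u.map m)
    rw [UU_m, VV_m] at this
    refine this.mono ?_
    have : ∀ z : List Bool, CC (z.map m) = 0 := by
      intro z
      induction z with
      | nil => rfl
      | cons a z ih => simp [CC, co, ih]
    simp [this]
  | succ h ih =>
    rintro u v ⟨w, hs, hr⟩
    obtain ⟨p, h1, h2, h3⟩ := ih w v hr
    cases hs with
    | repl x y a =>
      have := back_repl p x y (!a) a h1
      rw [h2] at this
      exact this.mono (by omega)
    | swap x y a =>
      have := back_swap p x y (!a) (by simpa using h1)
      rw [h2] at this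
      simp only [Bool.not_not] at this
      exact this.mono (by omega)

def BT : List (List Seg) := [[r true, r false], [r false, r true]]
def BH : List (List Seg) := [[s true], [s false]]

theorem VV_FF (p : List Seg) : VV (FF p) = UU p := by rw [VV, FF_FF]

theorem tilde_of_full {f : List Bool} (hf : full BT f = true) : TildeIsometric f := by
  intro n _ u v hu hv fu fv
  have hl : u.length = v.length := by omega
  have key := build (S := TStep) (f := f)
    (fun h u v => u.length = v.length ∧ tildeDist u v = h) ?_ ?_ _ u v fu fv ⟨hl, rfl⟩
  · obtain ⟨w, h0, h1, h2⟩ := reach_fun _ _ _ key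
    exact ⟨w, h0, h1, fun k hk => tilde_one_of (h2 k hk).1, path_free fu h0 h2⟩
  · rintro u v ⟨hl, hd⟩
    obtain ⟨p, _, rfl, rfl⟩ := exists_parse u v hl
    have := tilde_mem (reach_CC p)
    rw [hd] at this
    exact this
  · rintro h u v fu fv ⟨hl, hd⟩
    obtain ⟨p0, _, hu0, hv0⟩ := exists_parse u v hl
    have hr := reach_CC p0
    rw [hu0, hv0] at hr
    obtain ⟨p, rfl, rfl, hc⟩ := reach_par _ _ _ (tilde_mem hr)
    have hmin := tilde_le (reach_CC p)
    have hB : ∀ q ∈ BT, ¬ q <:+: p := by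
      have aux : ∀ b, ¬ [r b, r (!b)] <:+: p := by
        rintro b ⟨z, t, rfl⟩
        have e := tilde_le (reach_CC (z ++ [s b] ++ t))
        simp [UU_append, VV_append, CC_append, VV_cons, UU, us, fl, CC, co] at e hc
        omega
      intro q hq
      simp only [BT, List.mem_cons, List.not_mem_nil, or_false] at hq
      rcases hq with rfl | rfl
      · exact aux true
      · exact aux false
    rcases full_res hf p (by omega) hB fu fv with ⟨q, hq, hfq⟩ | ⟨q, hq, hfq⟩
    · obtain ⟨h1, h2, h3⟩ := umoves_spec hq
      refine ⟨UU q, hfq, Or.inl ⟨h3, by rw [← h3.len, hl], ?_⟩⟩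
      have r := reach_CC q
      rw [h2] at r
      have a := tilde_le r
      have b : tildeDist (UU p) (VV p) ≤ tildeDist (UU q) (VV p) + 1 :=
        tilde_le ⟨UU q, h3, tilde_mem r⟩
      omega
    · obtain ⟨h1, h2, h3⟩ := umoves_spec hq
      rw [VV_FF] at h2
      rw [CC_FF] at h1
      change TStep (VV p) _ at h3
      refine ⟨UU q, hfq, Or.inr ⟨h3.symm, by rw [← h3.len, hl], ?_⟩⟩
      have r := reach_symm (reach_CC q)
      rw [h2] at r
      have a := tilde_le r
      have b : tildeDist (UU p) (VV p) ≤ tildeDist (UU p) (UU q) + 1 :=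
        tilde_le (reach_snoc (tilde_mem r) h3.symm)
      omega

theorem ham_of_full {f : List Bool} (hf : full BH f = true) : HamIsometric f := by
  intro u v hl fu fv
  have key := build (S := fun a b => a.length = b.length ∧ hammDist a b = 1) (f := f)
    (fun h u v => u.length = v.length ∧ hammDist u v = h) ?_ ?_ _ u v fu fv ⟨hl, rfl⟩
  · obtain ⟨w, h0, h1, h2⟩ := reach_fun _ _ _ key
    refine ⟨w, h0, h1, ?_, fun k hk => (h2 k hk).1.2,
      path_free (S := fun a b => a.length = b.length ∧ hammDist a b = 1) fu h0 h2⟩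
    intro k
    induction k with
    | zero => intro _; rw [h0]
    | succ k ih => intro hk; rw [← (h2 k (by omega)).1.1, ih (by omega)]
  · rintro u v ⟨hl, hd⟩
    obtain ⟨p, hn, rfl, rfl⟩ := exists_parse u v hl
    rw [hamm_CC hn] at hd
    have := reach_CC p
    rw [hd] at this
    exact this
  · rintro h u v fu fv ⟨hl, hd⟩
    obtain ⟨p, hn, rfl, rfl⟩ := exists_parse u v hl
    rw [hamm_CC hn] at hd
    have hB : ∀ q ∈ BH, ¬ q <:+: p := by
      have aux : ∀ b, ¬ [s b] <:+: p := by
        intro b hb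
        exact hn (s b) (hb.subset (by simp)) b rfl
      intro q hq
      simp only [BH, List.mem_cons, List.not_mem_nil, or_false] at hq
      rcases hq with rfl | rfl
      · exact aux true
      · exact aux false
    rcases full_res hf p (by omega) hB fu fv with ⟨q, hq, hfq⟩ | ⟨q, hq, hfq⟩
    · obtain ⟨h1, h2, h3⟩ := umoves_spec hq
      obtain ⟨hn', h4⟩ := umoves_ham hn hq
      refine ⟨UU q, hfq, Or.inl ⟨⟨h3.len, h4⟩, by rw [← h3.len, hl], ?_⟩⟩
      rw [← h2, hamm_CC hn']
      omega
    · obtain ⟨h1, h2, h3⟩ := umoves_spec hq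
      obtain ⟨hn', h4⟩ := umoves_ham (NS_FF hn) hq
      rw [VV_FF] at h2
      rw [CC_FF] at h1
      change TStep (VV p) _ at h3
      change hammDist (VV p) _ = 1 at h4
      refine ⟨UU q, hfq, Or.inr ⟨⟨h3.len.symm, by rw [hammDist_comm]; exact h4⟩,
        by rw [← h3.len, hl], ?_⟩⟩
      rw [← h2, hammDist_comm, hamm_CC hn']
      omega

def nbrs : List Bool → List (List Bool)
  | [] => []
  | [a] => [[!a]]
  | a :: b :: l => ((!a) :: b :: l) :: (b :: a :: l) :: (nbrs (b :: l)).map (a :: ·)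

theorem nbrs_cons (a : Bool) (u w : List Bool) (h : w ∈ nbrs u) : a :: w ∈ nbrs (a :: u) := by
  cases u with
  | nil => simp [nbrs] at h
  | cons b l => simp [nbrs, h]

theorem mem_nbrs {u w : List Bool} (h : TStep u w) : w ∈ nbrs u := by
  cases h with
  | repl x y a =>
    induction x with
    | nil => cases y <;> simp [nbrs]
    | cons b x ih => exact nbrs_cons _ _ _ ih
  | swap x y a =>
    induction x with
    | nil => simp [nbrs]
    | cons b x ih => exact nbrs_cons _ _ _ ih

def cex (f : List Bool) (p : List Seg) : Bool :=
  decide (CC p = 2) && (decide (f.length ≤ (UU p).length) &&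
  (decide ((VV p).length = (UU p).length) && (decide (¬ f <:+: UU p) &&
  (decide (¬ f <:+: VV p) && (decide (UU p ≠ VV p) && (decide (VV p ∉ nbrs (UU p)) &&
  (nbrs (UU p)).all (fun w => decide (VV p ∈ nbrs w → f <:+: w))))))))

theorem not_tilde_of_cex {f : List Bool} {p : List Seg} (h : cex f p = true) :
    ¬ TildeIsometric f := by
  simp only [cex, Bool.and_eq_true, decide_eq_true_eq, List.all_eq_true] at h
  obtain ⟨h1, h2, h3, h4, h5, h6, h7, h8⟩ := h
  intro ht
  obtain ⟨w, w0, w1, w2, w3⟩ := ht _ h2 _ _ rfl h3 h4 h5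
  have hd := tilde_le (reach_CC p)
  rw [h1] at hd
  generalize tildeDist (UU p) (VV p) = d at *
  interval_cases d
  · exact h6 (w0.symm.trans w1)
  · have := mem_nbrs (step_of_tilde_one (w2 0 (by omega)))
    rw [w0] at this
    simp only [Nat.zero_add, w1] at this
    exact h7 this
  · have a := mem_nbrs (step_of_tilde_one (w2 0 (by omega)))
    have b := mem_nbrs (step_of_tilde_one (w2 1 (by omega)))
    rw [w0] at a
    simp only [Nat.zero_add, Nat.reduceAdd, w1] at a b
    exact w3 1 (by omega) (h8 _ a b)

def cexs : List (List Seg) :=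
  [[m false, r false, r false, m false],
   [s false, s true],
   [m false, m false, r false, r false, m false],
   [m false, s false, s false, m true],
   [m false, r false, r false, m false, m false],
   [m false, r false, s false, m true],
   [m false, r false, m true, r false, m false],
   [s false, m false, s true],
   [s false, s true, m false],
   [s false, r true, m true, m true],
   [m true, s false, s false, m false],
   [m true, m true, r false, s false]]

theorem small_words : ∀ f ∈ ctxs 4, full BH f = true ∨ ∃ p ∈ cexs, cex f p = true := by
  decide +kernel

theorem full_main : full BT [true, true, true, false, false] = true := by
  decide +kernel

theorem ham_bad : ∀ w ∈ ctxs 8, w.length = 8 →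
    hammDist [true, true, true, false, true, true, false, false] w = 1 →
    hammDist w [true, true, true, true, false, true, false, false] = 1 →
    [true, true, true, false, false] <:+: w := by
  decide +kernel

theorem not_ham_main : ¬ HamIsometric [true, true, true, false, false] := by
  intro h
  obtain ⟨w, w0, w1, w2, w3, w4⟩ := h [true, true, true, false, true, true, false, false]
    [true, true, true, true, false, true, false, false] rfl (by decide) (by decide)
  have hd : hammDist [true, true, true, false, true, true, false, false]
    [true, true, true, true, false, true, false, false] = 2 := by decide
  rw [hd] at w1 w2 w3 w4
  have l := w2 1 (by omega)
  have a := w3 0 (by omega)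
  have b := w3 1 (by omega)
  rw [w0] at a
  simp only [Nat.zero_add, Nat.reduceAdd, w1] at a b
  have l' : (w 1).length = 8 := l
  exact w4 1 (by omega) (ham_bad _ (mem_ctxs 8 _ (by omega)) l' a b)

/-- `11100` is the shortest tilde-isometric word that is not Ham-isometric. -/
theorem shortest_tilde_not_ham :
    TildeIsometric [true, true, true, false, false] ∧
    ¬ HamIsometric [true, true, true, false, false] ∧
    (∀ f : List Bool, f.length ≤ 4 → TildeIsometric f → HamIsometric f) := by
  refine ⟨tilde_of_full full_main, not_ham_main, ?_⟩
  intro f hf ht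
  rcases small_words f (mem_ctxs 4 f hf) with h | ⟨p, _, h⟩
  · exact ham_of_full h
  · exact absurd ht (not_tilde_of_cex h)
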